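/- The plethysm e_k ∘ h₂ equals the sum of Schur functions s_{Γ(β)'} over all strict partitions β of k, where Γ(β) is the partition with Frobenius coordinates (β₁−1, β₂−1, … | β₁, β₂, …) and ' denotes conjugation. -/

import Mathlib

open MvPolynomial Finset

/-- The ring of symmetric functions (with rational coefficients), realized as the free
commutative `ℚ`-algebra on the complete homogeneous symmetric functions `h₁, h₂, …`,
where the variable `n : ℕ` corresponds to `h_{n+1}`. -/
abbrev SymFn : Type := MvPolynomial ℕ ℚ

/-- The complete homogeneous symmetric function `h_n`, with `h_n = 0` for `n < 0`
and `h_0 = 1`. -/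
noncomputable def hh (n : ℤ) : SymFn :=
  if n < 0 then 0 else if n = 0 then 1 else MvPolynomial.X (n.toNat - 1)

/-- The power sum symmetric functions, defined from the `h`'s by Newton's identities:
`p_k = k h_k - ∑_{i=1}^{k-1} h_i p_{k-i}`. -/
noncomputable def pp : ℕ → SymFn
  | 0 => 0
  | (k+1) => ((k : ℚ) + 1) • hh (k+1) - ∑ i ∈ Finset.range k, hh (i+1) * pp (k - i)
  decreasing_by exact Nat.lt_succ_of_le (Nat.sub_le _ _)

/-- `h_m` written as a polynomial in the power sums (the variable `j` stands for `p_{j+1}`),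
via the recursion `m h_m = ∑_{i=1}^{m} p_i h_{m-i}`. -/
noncomputable def hInP : ℕ → MvPolynomial ℕ ℚ
  | 0 => 1
  | (m+1) => ((m : ℚ) + 1)⁻¹ •
      ∑ i ∈ Finset.range (m+1), MvPolynomial.X i * hInP (m - i)
  decreasing_by exact Nat.lt_succ_of_le (Nat.sub_le _ _)

/-- The `k`-th Adams operation: the algebra endomorphism of `SymFn` determined by
`p_m ↦ p_{k m}` on power sums. -/
noncomputable def adams (k : ℕ) : SymFn →ₐ[ℚ] SymFn :=
  aeval fun m => (aeval fun j => pp (k * (j+1))) (hInP (m+1))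

/-- The plethysm `h_k ∘ g`, via the recursion
`k (h_k ∘ g) = ∑_{i=1}^{k} (p_i ∘ g) (h_{k-i} ∘ g)`, where `p_i ∘ g = adams i g`. -/
noncomputable def hPleth (g : SymFn) : ℕ → SymFn
  | 0 => 1
  | (k+1) => ((k : ℚ) + 1)⁻¹ •
      ∑ i ∈ Finset.range (k+1), adams (i+1) g * hPleth g (k - i)
  decreasing_by exact Nat.lt_succ_of_le (Nat.sub_le _ _)

/-- The (outer) plethysm `f ∘ g` of symmetric functions: the algebra homomorphism
in the left argument sending `h_k ↦ h_k ∘ g`. -/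
noncomputable def pleth (f g : SymFn) : SymFn := aeval (fun m => hPleth g (m+1)) f

/-- The elementary symmetric functions, via `e_k = ∑_{i=1}^{k} (-1)^{i-1} h_i e_{k-i}`. -/
noncomputable def ee : ℕ → SymFn
  | 0 => 1
  | (k+1) => ∑ i ∈ Finset.range (k+1), ((-1 : ℚ))^i • (hh (i+1) * ee (k - i))
  decreasing_by exact Nat.lt_succ_of_le (Nat.sub_le _ _)

/-- The parts of a multiset, as a weakly decreasing list. -/
def sortedParts (m : Multiset ℕ) : List ℕ := (m.sort (· ≤ ·)).reverse

/-- The Schur function `s_m`, via the Jacobi–Trudi determinant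
`s_λ = det (h_{λ_i + j - i})`. -/
noncomputable def schur (m : Multiset ℕ) : SymFn :=
  Matrix.det (Matrix.of fun i j : Fin (Multiset.card m) =>
    hh (((sortedParts m).getD i 0 : ℤ) + (j : ℤ) - (i : ℤ)))

/-- A multiset of naturals is a partition when all its parts are positive. -/
def IsPartition (m : Multiset ℕ) : Prop := 0 ∉ m

/-- A strict partition: positive, pairwise distinct parts. -/
def IsStrictPartition (m : Multiset ℕ) : Prop := 0 ∉ m ∧ m.Nodup

/-- The first (largest) part `λ₁` of a partition. -/
def firstPart (m : Multiset ℕ) : ℕ := m.sup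

/-- The size `|λ|` of a partition. -/
def psize (m : Multiset ℕ) : ℕ := m.sum

/-- The conjugate (transposed) partition. -/
def conj (m : Multiset ℕ) : Multiset ℕ :=
  ((List.range m.sup).map fun i => Multiset.card (m.filter fun x => i < x) : List ℕ)

/-- The partition `ν[N] = (N - |ν|, ν₁, ν₂, …)` (valid when `N ≥ |ν| + ν₁`). -/
def padded (ν : Multiset ℕ) (N : ℕ) : Multiset ℕ := (N - ν.sum) ::ₘ ν

/-- `c` is the expansion of `f` in the basis of Schur functions indexed by partitions. -/
def SchurExpansion (f : SymFn) (c : Multiset ℕ →₀ ℚ) : Prop :=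
  (∀ κ ∈ c.support, IsPartition κ) ∧ f = c.sum fun κ a => a • schur κ

/-- `Φ` of a Schur expansion: the largest first part of a partition occurring in it. -/
def Phi (c : Multiset ℕ →₀ ℚ) : ℕ := c.support.sup firstPart

/-- The partition `2α`, doubling every part. -/
def double (m : Multiset ℕ) : Multiset ℕ := m.map (2 * ·)

/-- For a strict partition `β = (β₁ > β₂ > … > β_r > 0)`, the partition `Γ(β)` with
Frobenius coordinates `(β₁ - 1, …, β_r - 1 | β₁, …, β_r)`. -/
def gammaFrob (β : Multiset ℕ) : Multiset ℕ :=
  let b := sortedParts β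
  let r := b.length
  (((List.range r).map fun i => b.getD i 0 + i)
    ++ ((List.range (b.getD 0 0 + 1 - r)).map fun t =>
        ((List.range r).filter fun j => r + t ≤ b.getD j 0 + j).length) : List ℕ)


section PartOne

variable {R : Type*} [CommRing R] {ι : Type*}

/-- generating series of complete symmetric functions -/
noncomputable def HS (s : Finset ι) (y : ι → R) : PowerSeries R :=
  ∏ i ∈ s, PowerSeries.mk (fun m => y i ^ m)

noncomputable def hc (s : Finset ι) (y : ι → R) (m : ℕ) : R := PowerSeries.coeff m (HS s y)

noncomputable def EP (s : Finset ι) (y : ι → R) : Polynomial R :=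
  ∏ i ∈ s, (1 - Polynomial.C (y i) * Polynomial.X)

theorem geo_mul (a : R) :
    (PowerSeries.mk (fun m => a ^ m)) * (1 - PowerSeries.C a * PowerSeries.X) = 1 := by
  ext n
  rw [mul_sub, mul_one, ← mul_assoc, mul_comm _ (PowerSeries.C a), mul_assoc, map_sub]
  cases n with
  | zero => simp
  | succ n =>
    rw [PowerSeries.coeff_C_mul, PowerSeries.coeff_succ_mul_X]
    simp [pow_succ, PowerSeries.coeff_one, mul_comm]

theorem HS_mul_EP (s : Finset ι) (y : ι → R) : HS s y * (EP s y : PowerSeries R) = 1 := by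
  have : (EP s y : PowerSeries R) = ∏ i ∈ s, (1 - PowerSeries.C (y i) * PowerSeries.X) := by
    unfold EP
    rw [← Polynomial.coeToPowerSeries.ringHom_apply, map_prod]
    simp
  rw [this, HS, ← Finset.prod_mul_distrib]
  exact Finset.prod_eq_one fun i _ => geo_mul _

theorem hc_zero (s : Finset ι) (y : ι → R) : hc s y 0 = 1 := by
  simp [hc, HS, ← PowerSeries.coeff_zero_eq_constantCoeff_apply, PowerSeries.coeff_zero_eq_constantCoeff, map_prod]

theorem deriv_geo (a : R) : PowerSeries.derivative R (PowerSeries.mk (fun m => a ^ m)) =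
    PowerSeries.mk (fun m => a ^ m) * PowerSeries.mk (fun m => a ^ (m+1)) := by
  have h1 := geo_mul a
  have h2 : PowerSeries.mk (fun m => a ^ (m+1)) = PowerSeries.C a * PowerSeries.mk (fun m => a ^ m) := by
    ext n; simp [pow_succ, mul_comm]
  have h3 := congrArg (PowerSeries.derivative R) h1
  rw [Derivation.leibniz] at h3
  simp only [map_sub, Derivation.leibniz, PowerSeries.derivative_C, PowerSeries.derivative_X, smul_eq_mul, Derivation.map_one_eq_zero] at h3
  rw [h2]
  set G := PowerSeries.mk (fun m => a ^ m) with hG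
  linear_combination G * h3 - (PowerSeries.derivative R G) * h1

theorem deriv_HS (s : Finset ι) (y : ι → R) : PowerSeries.derivative R (HS s y) =
    HS s y * PowerSeries.mk (fun m => ∑ i ∈ s, y i ^ (m+1)) := by
  classical
  induction s using Finset.induction_on with
  | empty => simp [HS]; ext; simp
  | insert a s ha ih =>
    have e : PowerSeries.mk (fun m => ∑ i ∈ insert a s, y i ^ (m+1)) =
      PowerSeries.mk (fun m => y a ^ (m+1)) + PowerSeries.mk (fun m => ∑ i ∈ s, y i ^ (m+1)) := by
      ext n; simp [Finset.sum_insert ha]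
    have e2 : HS (insert a s) y = PowerSeries.mk (fun m => y a ^ m) * HS s y := by
      simp [HS, Finset.prod_insert ha]
    rw [e2, Derivation.leibniz, ih, deriv_geo, e]
    simp only [smul_eq_mul]
    ring

theorem hc_newton (s : Finset ι) (y : ι → R) (m : ℕ) : ((m : R) + 1) * hc s y (m+1) =
    ∑ i ∈ Finset.range (m+1), (∑ j ∈ s, y j ^ (i+1)) * hc s y (m - i) := by
  have := congrArg (PowerSeries.coeff m) (deriv_HS s y)
  rw [PowerSeries.coeff_derivative, mul_comm (HS s y), PowerSeries.coeff_mul,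
    Finset.Nat.sum_antidiagonal_eq_sum_range_succ (fun i j => (PowerSeries.coeff i) (PowerSeries.mk (fun m => ∑ i ∈ s, y i ^ (m+1))) * (PowerSeries.coeff j) (HS s y))] at this
  simp only [PowerSeries.coeff_mk] at this
  rw [mul_comm]; exact this

theorem EP_coeff_zero (s : Finset ι) (y : ι → R) : (EP s y).coeff 0 = 1 := by
  rw [EP, Polynomial.coeff_zero_prod]; simp

theorem EP_rec (s : Finset ι) (y : ι → R) (k : ℕ) : (EP s y).coeff (k+1) =
    - ∑ i ∈ Finset.range (k+1), hc s y (i+1) * (EP s y).coeff (k - i) := by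
  have := congrArg (PowerSeries.coeff (k+1)) (HS_mul_EP s y)
  rw [PowerSeries.coeff_mul,
    Finset.Nat.sum_antidiagonal_eq_sum_range_succ (fun i j => (PowerSeries.coeff i) (HS s y) * (PowerSeries.coeff j) (EP s y : PowerSeries R)), Finset.sum_range_succ'] at this
  simp only [Polynomial.coeff_coe] at this
  change _ + hc s y 0 * _ = _ at this
  rw [hc_zero, PowerSeries.coeff_one, if_neg (by omega)] at this
  simp only [Nat.add_sub_add_right] at this
  rw [eq_neg_iff_add_eq_zero, add_comm]
  simpa [hc] using this

noncomputable def hz (s : Finset ι) (y : ι → R) (m : ℤ) : R := if m < 0 then 0 else hc s y m.toNat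

theorem hz_nat (s : Finset ι) (y : ι → R) (m : ℕ) : hz s y m = hc s y m := by
  simp [hz]

variable [Algebra ℚ R]

noncomputable def phi (s : Finset ι) (y : ι → R) : SymFn →ₐ[ℚ] R := aeval fun m => hc s y (m+1)

theorem phi_hh (s : Finset ι) (y : ι → R) (m : ℤ) : phi s y (hh m) = hz s y m := by
  unfold hh hz
  split_ifs with h1 h2
  · simp
  · subst h2; simp [hc_zero]
  · simp only [phi, aeval_X]
    congr 1; omega

theorem phi_pp (s : Finset ι) (y : ι → R) (k : ℕ) : phi s y (pp (k+1)) = ∑ j ∈ s, y j ^ (k+1) := by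
  induction k using Nat.strong_induction_on with
  | _ k ih =>
    rw [pp, map_sub, map_smul, map_sum, phi_hh]
    have e : ∀ i ∈ Finset.range k, phi s y (hh ((i:ℤ)+1) * pp (k - i)) =
        hc s y (i+1) * (∑ j ∈ s, y j ^ (k-i)) := by
      intro i hi
      rw [Finset.mem_range] at hi
      obtain ⟨d, rfl⟩ := Nat.exists_eq_add_of_lt hi
      have : i + d + 1 - i = d + 1 := by omega
      rw [map_mul, phi_hh, this, ih d (by omega)]
      rw [← hz_nat]; push_cast; rfl
    rw [Finset.sum_congr rfl e]
    have h := hc_newton s y k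
    rw [Finset.sum_range_succ, Nat.sub_self, hc_zero, mul_one, ← Finset.sum_range_reflect] at h
    have e2 : ∀ i ∈ Finset.range k, (∑ j ∈ s, y j ^ (k - 1 - i + 1)) * hc s y (k - (k - 1 - i)) =
       hc s y (i+1) * (∑ j ∈ s, y j ^ (k-i)) := by
      intro i hi
      rw [Finset.mem_range] at hi
      rw [show k - 1 - i + 1 = k - i by omega, show k - (k-1-i) = i+1 by omega, mul_comm]
    rw [Finset.sum_congr rfl e2] at h
    have e3 : hz s y ((k:ℤ)+1) = hc s y (k+1) := by rw [← hz_nat]; push_cast; rfl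
    rw [e3, Algebra.smul_def]
    simp only [map_add, map_natCast, map_one]
    rw [h]; ring

theorem phi_adams (s : Finset ι) (y : ι → R) (k : ℕ) : (2:ℚ) • phi s y (adams (k+1) (hh 2)) =
    (∑ j ∈ s, y j ^ (k+1))^2 + ∑ j ∈ s, y j ^ (2*(k+1)) := by
  have h2 : hh 2 = MvPolynomial.X 1 := by simp [hh]
  have e : hInP 2 = (2:ℚ)⁻¹ • (MvPolynomial.X 0 * MvPolynomial.X 0 + MvPolynomial.X 1) := by
    rw [hInP, Finset.sum_range_succ, Finset.sum_range_one]
    simp [hInP]; norm_num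
  rw [h2, adams, aeval_X, e]
  simp only [map_smul, map_add, map_mul, aeval_X]
  rw [smul_smul]
  have a1 : (k+1) * (0+1) = k + 1 := by ring
  have a2 : (k+1) * (1+1) = (2*k+1)+1 := by ring
  rw [a1, a2, phi_pp, phi_pp]
  norm_num
  rw [sq]; congr 1

theorem phi_hPleth {κ : Type*} (s : Finset ι) (y : ι → R) (t : Finset κ) (z : κ → R)
    (h : ∀ k, (2:ℚ) • ∑ j ∈ t, z j ^ (k+1) = (∑ j ∈ s, y j ^ (k+1))^2 + ∑ j ∈ s, y j ^ (2*(k+1))) (m : ℕ) :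
    phi s y (hPleth (hh 2) m) = hc t z m := by
  have h' : ∀ k, phi s y (adams (k+1) (hh 2)) = ∑ j ∈ t, z j ^ (k+1) := by
    intro k
    have := (phi_adams s y k).trans (h k).symm
    have := congrArg (fun r => (2:ℚ)⁻¹ • r) this
    simpa [smul_smul] using this
  induction m using Nat.strong_induction_on with
  | _ m ih =>
    cases m with
    | zero => simp [hPleth, hc_zero]
    | succ m =>
      rw [hPleth, map_smul, map_sum]
      have e : ∀ i ∈ Finset.range (m+1), phi s y (adams (i+1) (hh 2) * hPleth (hh 2) (m - i)) =
          (∑ j ∈ t, z j ^ (i+1)) * hc t z (m - i) := by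
        intro i hi
        rw [map_mul, h', ih _ (by omega)]
      rw [Finset.sum_congr rfl e, ← hc_newton]
      have : ((m:R)+1) * hc t z (m+1) = ((m:ℚ)+1) • hc t z (m+1) := by
        rw [Algebra.smul_def]; simp
      rw [this, smul_smul, inv_mul_cancel₀ (by positivity), one_smul]

theorem pleth_ee_zero (g : SymFn) : pleth (ee 0) g = 1 := by simp [pleth, ee]

theorem pleth_ee_succ (g : SymFn) (k : ℕ) : pleth (ee (k+1)) g =
    ∑ i ∈ Finset.range (k+1), ((-1 : ℚ))^i • (hPleth g (i+1) * pleth (ee (k-i)) g) := by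
  unfold pleth
  rw [ee, map_sum]
  refine Finset.sum_congr rfl fun i _ => ?_
  rw [map_smul, map_mul]
  congr 2
  have : hh ((i:ℤ)+1) = MvPolynomial.X i := by
    unfold hh
    rw [if_neg (by omega), if_neg (by omega)]
    congr 1
  rw [this, aeval_X]

theorem phi_pleth {κ : Type*} (s : Finset ι) (y : ι → R) (t : Finset κ) (z : κ → R)
    (h : ∀ k, (2:ℚ) • ∑ j ∈ t, z j ^ (k+1) = (∑ j ∈ s, y j ^ (k+1))^2 + ∑ j ∈ s, y j ^ (2*(k+1))) (k : ℕ) :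
    phi s y (pleth (ee k) (hh 2)) = (-1)^k * (EP t z).coeff k := by
  induction k using Nat.strong_induction_on with
  | _ k ih =>
    cases k with
    | zero => simp [pleth_ee_zero, EP_coeff_zero]
    | succ k =>
      rw [pleth_ee_succ, map_sum, EP_rec, mul_neg, Finset.mul_sum, ← Finset.sum_neg_distrib]
      refine Finset.sum_congr rfl fun i hi => ?_
      rw [Finset.mem_range] at hi
      rw [map_smul, map_mul, ih _ (by omega), phi_hPleth s y t z h, Algebra.smul_def]
      have : (-1 : R)^(k+1) = - ((-1)^i * (-1)^(k-i)) := by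
        rw [← pow_add, Nat.add_sub_cancel' (by omega), pow_succ]; ring
      rw [this]
      simp only [map_pow, map_neg, map_one]
      ring

end PartOne

section PartTwo

variable {R : Type*} [CommRing R]

theorem EP_natDegree {ι : Type*} (s : Finset ι) (y : ι → R) : (EP s y).natDegree ≤ s.card := by
  unfold EP
  refine (Polynomial.natDegree_prod_le _ _).trans ?_
  calc _ ≤ ∑ i ∈ s, 1 := Finset.sum_le_sum fun i _ => by compute_degree
    _ = _ := by simp

theorem key_sum {n : ℕ} (y : Fin n → R) (k : Fin n) (c : ℕ) :
    ∑ i : Fin n, (EP (Finset.univ.erase k) y).coeff i * hz Finset.univ y ((c:ℤ) - (i:ℕ)) = y k ^ c := by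
  have h1 : (EP (Finset.univ.erase k) y : PowerSeries R) * HS Finset.univ y =
      PowerSeries.mk (fun m => y k ^ m) := by
    have e : HS Finset.univ y = PowerSeries.mk (fun m => y k ^ m) * HS (Finset.univ.erase k) y := by
      exact (Finset.mul_prod_erase Finset.univ (fun i => PowerSeries.mk (fun m => y i ^ m)) (Finset.mem_univ k)).symm
    rw [e, mul_left_comm, mul_comm (Polynomial.toPowerSeries _), HS_mul_EP, mul_one]
  have h2 := congrArg (PowerSeries.coeff c) h1
  rw [PowerSeries.coeff_mul, PowerSeries.coeff_mk,
    Finset.Nat.sum_antidiagonal_eq_sum_range_succ (fun i j => (PowerSeries.coeff i) (EP (Finset.univ.erase k) y : PowerSeries R) * (PowerSeries.coeff j) (HS Finset.univ y))] at h2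
  simp only [Polynomial.coeff_coe] at h2
  rw [← h2, Fin.sum_univ_eq_sum_range (fun i => (EP (Finset.univ.erase k) y).coeff i * hz Finset.univ y ((c:ℤ) - (i:ℕ)))]
  have z1 : ∀ i, c < i → hz Finset.univ y ((c:ℤ) - (i:ℕ)) = 0 := by
    intro i hi; rw [hz, if_pos (by omega)]
  have z2 : ∀ i, n ≤ i → (EP (Finset.univ.erase k) y).coeff i = 0 := by
    intro i hi
    apply Polynomial.coeff_eq_zero_of_natDegree_lt
    refine (EP_natDegree _ _).trans_lt ?_
    rw [Finset.card_erase_of_mem (Finset.mem_univ k), Finset.card_univ, Fintype.card_fin]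
    have := k.2; omega
  have e3 : ∑ i ∈ Finset.range c.succ, (EP (Finset.univ.erase k) y).coeff i * (PowerSeries.coeff (c - i)) (HS Finset.univ y) =
     ∑ i ∈ Finset.range c.succ, (EP (Finset.univ.erase k) y).coeff i * hz Finset.univ y ((c:ℤ) - (i:ℕ)) := by
    refine Finset.sum_congr rfl fun i hi => ?_
    rw [Finset.mem_range] at hi
    rw [show (c:ℤ) - (i:ℕ) = ((c - i : ℕ) : ℤ) by omega, hz_nat]; rfl
  rw [e3]
  trans ∑ i ∈ Finset.range (n + c.succ), (EP (Finset.univ.erase k) y).coeff i * hz Finset.univ y ((c:ℤ) - (i:ℕ))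
  · refine Finset.sum_subset (by intro i; simp; omega) fun i _ hi => ?_
    rw [z2 i (by simpa using hi), zero_mul]
  · refine (Finset.sum_subset (by intro i; simp; omega) fun i _ hi => ?_).symm
    rw [z1 i (by simp at hi; omega), mul_zero]

theorem vand_mul_det {n : ℕ} (y : Fin n → R) :
    (Matrix.vandermonde y).det * (Matrix.of fun i c : Fin n => hz Finset.univ y ((c:ℕ) - (i:ℕ) : ℤ) - hz Finset.univ y ((2*n - c : ℕ) - (i:ℕ) : ℤ)).det =
    (Matrix.of fun k c : Fin n => y k ^ (c:ℕ) - y k ^ (2*n - c : ℕ)).det := by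
  set A : Matrix (Fin n) (Fin n) R := Matrix.of fun k i => (EP (Finset.univ.erase k) y).coeff i
  set H : Matrix (Fin n) (Fin n) R := Matrix.of fun i c => hz Finset.univ y ((c:ℕ) - (i:ℕ) : ℤ)
  have h1 : A * H = Matrix.vandermonde y := by
    ext k c
    rw [Matrix.mul_apply]
    exact key_sum y k c
  have h2 : H.det = 1 := by
    rw [Matrix.det_of_isUpperTriangular]
    · refine Finset.prod_eq_one fun i _ => ?_
      change hz _ y _ = 1
      rw [sub_self, hz]; simp [hc_zero]
    · intro i j hij
      change hz _ y _ = 0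
      have : (j:ℕ) < i := hij
      rw [hz, if_pos (by omega)]
  have h3 : A.det = (Matrix.vandermonde y).det := by rw [← h1, Matrix.det_mul, h2, mul_one]
  rw [← h3, ← Matrix.det_mul]
  congr 1
  ext k c
  rw [Matrix.mul_apply, Matrix.of_apply, ← key_sum y k c, ← key_sum y k (2*n-c), ← Finset.sum_sub_distrib]
  refine Finset.sum_congr rfl fun i _ => ?_
  simp only [A, Matrix.of_apply]; ring

/-- coefficients of the Chebyshev-like polynomials -/
def bco : ℕ → ℕ → ℤ
  | 0, l => if l = 0 then 1 else 0
  | 1, l => if l = 0 then 1 else 0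
  | (d+2), l => bco (d+1) l - (if 2 ≤ l then bco d (l-2) else 0)

theorem bco_zero (d : ℕ) : bco d 0 = 1 := by
  induction d using Nat.twoStepInduction with
  | zero => simp [bco]
  | one => simp [bco]
  | more d _ h => simp [bco, h]

theorem bco_gt (d l : ℕ) (h : d < l) : bco d l = 0 := by
  induction d using Nat.twoStepInduction generalizing l with
  | zero => simp [bco]; omega
  | one => simp [bco]; omega
  | more d h1 h2 => rw [bco, h2 l (by omega), if_pos (by omega), h1 _ (by omega)]; simp

theorem bco_sum (d : ℕ) (y : R) : ∑ s ∈ Finset.range (d+1), y^(2*s) =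
    ∑ l ∈ Finset.range (d+1), (bco d l : R) * (y^l * (1+y^2)^(d-l)) := by
  induction d using Nat.twoStepInduction with
  | zero => simp [bco]
  | one => simp [bco, Finset.sum_range_succ]
  | more d h1 h2 =>
    have e1 : ∑ s ∈ Finset.range (d+3), y^(2*s) = (1+y^2) * ∑ s ∈ Finset.range (d+2), y^(2*s)
        - y^2 * ∑ s ∈ Finset.range (d+1), y^(2*s) := by
      rw [Finset.sum_range_succ, Finset.sum_range_succ (n := d+1)]
      ring
    rw [e1, h1, h2]
    simp only [bco, Int.cast_sub, sub_mul, Finset.sum_sub_distrib]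
    congr 1
    · rw [Finset.sum_range_succ (n := d+2), bco_gt (d+1) (d+2) (by omega), Finset.mul_sum]
      simp only [Int.cast_zero, zero_mul, add_zero]
      refine Finset.sum_congr rfl fun l hl => ?_
      rw [Finset.mem_range] at hl
      rw [show d + 2 - l = (d+1-l)+1 by omega, pow_succ]; ring
    · rw [Finset.mul_sum, Finset.sum_range_succ' (n := d+2), Finset.sum_range_succ' (n := d+1)]
      simp only [Nat.reduceAdd]
      simp
      refine Finset.sum_congr rfl fun l hl => ?_
      rw [Finset.mem_range] at hl
      ring

theorem det_typeC {n : ℕ} (y : Fin n → R) :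
    (Matrix.of fun k c : Fin n => y k ^ (c:ℕ) - y k ^ (2*n - c : ℕ)).det =
    (Matrix.vandermonde y).det * ((∏ i, (1 - y i * y i)) * ∏ i, ∏ j ∈ Finset.Ioi i, (1 - y i * y j)) := by
  set B : Matrix (Fin n) (Fin n) R := Matrix.of fun j c =>
    if c ≤ j then (bco (n-1-c) (j - c) : R) else 0
  have hB : B.det = 1 := by
    rw [Matrix.det_of_isLowerTriangular]
    · refine Finset.prod_eq_one fun i _ => ?_
      simp [B, bco_zero]
    · intro i j hij
      have : i < j := hij
      simp [B, not_le.mpr this]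
  have h1 : (Matrix.of fun k c : Fin n => y k ^ (c:ℕ) - y k ^ (2*n - c : ℕ)) =
      Matrix.of fun k c => (1 - y k * y k) * (Matrix.projVandermonde y (fun i => 1 + y i^2) * B) k c := by
    ext k c
    have hc := c.2
    have e : (Matrix.projVandermonde y (fun i => 1 + y i^2) * B) k c =
        y k^(c:ℕ) * ∑ s ∈ Finset.range (n-1-c+1), y k^(2*s) := by
      rw [bco_sum, Matrix.mul_apply]
      simp only [Matrix.projVandermonde_apply, B, Matrix.of_apply, Fin.val_rev, Fin.le_def]
      rw [Fin.sum_univ_eq_sum_range (fun j => y k ^ j * (1 + y k^2)^(n - (j+1)) * (if (c:ℕ) ≤ j then (bco (n-1-c) (j-c) : R) else 0)),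
        Finset.range_eq_Ico, ← Finset.sum_Ico_consecutive _ (Nat.zero_le c) hc.le, Finset.sum_eq_zero, zero_add,
        Finset.sum_Ico_eq_sum_range, show n - 1 - (c:ℕ) + 1 = n - c by omega, Finset.mul_sum]
      · rw [Finset.range_eq_Ico]
        refine Finset.sum_congr rfl fun l hl => ?_
        rw [if_pos (by omega), show (c:ℕ) + l - c = l by omega, show n - (c + l + 1) = n - 1 - c - l by omega, pow_add]
        ring
      · intro l hl
        rw [Finset.mem_Ico] at hl
        rw [if_neg (by omega), mul_zero]
    rw [Matrix.of_apply, Matrix.of_apply, e]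
    have g := geom_sum_mul (y k^2) (n-1-c+1)
    simp only [← pow_mul] at g
    have : (2*n - c : ℕ) = c + 2 * (n-1-c+1) := by omega
    rw [this, pow_add]
    linear_combination (y k^(c:ℕ)) * g
  rw [h1, Matrix.det_mul_column (fun k => 1 - y k * y k) (Matrix.projVandermonde y (fun i => 1 + y i^2) * B),
    Matrix.det_mul, hB, mul_one, Matrix.det_projVandermonde, Matrix.det_vandermonde, mul_left_comm]
  congr 1
  simp only [← Finset.prod_mul_distrib]
  refine Finset.prod_congr rfl fun i _ => Finset.prod_congr rfl fun j _ => ?_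
  ring

end PartTwo

section PartThree

/-- increasing sequence of column indices attached to a set of parts -/
def asc : (n : ℕ) → Finset ℕ → Fin n → ℕ
  | 0, _ => Fin.elim0
  | n+1, S => if n+1 ∈ S then Fin.snoc (α := fun _ => ℕ) (fun i => asc n S i + 1) (2*n+2)
      else Fin.cons 0 (fun i => asc n S i + 1)

theorem asc_congr (n : ℕ) (S S' : Finset ℕ) (h : ∀ m ≤ n, m ∈ S ↔ m ∈ S') : asc n S = asc n S' := by
  induction n with
  | zero => rfl
  | succ n ih =>
    have := ih fun m hm => h m (by omega)
    simp only [asc, this, h (n+1) le_rfl]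

theorem asc_pos (n : ℕ) (S : Finset ℕ) (h : n+1 ∈ S) :
    asc (n+1) S = Fin.snoc (α := fun _ => ℕ) (fun i => asc n S i + 1) (2*n+2) := by
  rw [asc, if_pos h]

theorem asc_neg (n : ℕ) (S : Finset ℕ) (h : n+1 ∉ S) :
    asc (n+1) S = Fin.cons 0 (fun i => asc n S i + 1) := by
  rw [asc, if_neg h]

theorem sum_asc (n : ℕ) (S : Finset ℕ) (hS : S ⊆ Finset.Icc 1 n) :
    ∑ i, asc n S i = (∑ i : Fin n, (i:ℕ)) + 2 * S.sum id := by
  induction n generalizing S with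
  | zero => simp at hS; simp [hS]
  | succ n ih =>
    have hS' : S.erase (n+1) ⊆ Finset.Icc 1 n := by
      intro x hx
      rw [Finset.mem_erase] at hx
      have := Finset.mem_Icc.1 (hS hx.2)
      rw [Finset.mem_Icc]; omega
    have e : asc n S = asc n (S.erase (n+1)) :=
      asc_congr _ _ _ fun m hm => by simp; intro _; omega
    have := ih _ hS'
    by_cases h : n+1 ∈ S
    · rw [asc_pos n S h, Fin.sum_univ_castSucc]
      simp only [Fin.snoc_castSucc, Fin.snoc_last, Finset.sum_add_distrib, e, this]
      rw [Fin.sum_univ_castSucc, ← Finset.add_sum_erase S id h]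
      simp
      ring
    · rw [Finset.erase_eq_of_notMem h] at this
      rw [asc_neg n S h, Fin.sum_univ_succ, Fin.sum_univ_succ]
      simp [Finset.sum_add_distrib, this]
      ring

theorem alt_expand {A M N : Type*} [CommRing A] [AddCommGroup M] [AddCommGroup N] [Module A M] [Module A N]
    (n : ℕ) (f : M [⋀^Fin n]→ₗ[A] N) (v : ℕ → M) :
    f (fun c => v c - v (2*n - c)) =
      ∑ S ∈ (Finset.Icc 1 n).powerset, (-1:ℤ)^(S.sum id) • f (fun i => v (asc n S i)) := by
  induction n generalizing v with
  | zero => 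
    simp
    congr 1
    exact Subsingleton.elim _ _
  | succ n ih =>
    have hI : Finset.Icc 1 (n+1) = insert (n+1) (Finset.Icc 1 n) := by
      ext x; simp; omega
    have e0 : (fun c : Fin (n+1) => v c - v (2*(n+1) - c)) =
        Matrix.vecCons (v 0 - v (2*n+2)) (fun c : Fin n => v (c+1) - v ((2*n - c)+1)) := by
      funext c
      refine Fin.cases ?_ (fun c => ?_) c
      · simp; rfl
      · simp only [Matrix.cons_val_succ, Fin.val_succ]
        congr 2; have := c.2; omega
    rw [e0, ← AlternatingMap.curryLeft_apply_apply, map_sub, AlternatingMap.sub_apply,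
      ih (f.curryLeft (v 0)) (fun m => v (m+1)), ih (f.curryLeft (v (2*n+2))) (fun m => v (m+1)),
      hI, Finset.sum_powerset_insert (by simp), sub_eq_add_neg, ← Finset.sum_neg_distrib]
    congr 1
    · refine Finset.sum_congr rfl fun S hS => ?_
      rw [Finset.mem_powerset] at hS
      have hn : n+1 ∉ S := fun h => by have := hS h; simp at this
      rw [asc_neg n S hn, AlternatingMap.curryLeft_apply_apply]
      congr 2
      funext c
      refine Fin.cases ?_ (fun c => ?_) c <;> simp
    · refine Finset.sum_congr rfl fun S hS => ?_
      rw [Finset.mem_powerset] at hS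
      have hn : n+1 ∉ S := fun h => by have := hS h; simp at this
      have e : asc n (insert (n+1) S) = asc n S :=
        asc_congr _ _ _ fun m hm => by simp; omega
      rw [asc_pos n _ (Finset.mem_insert_self _ _), AlternatingMap.curryLeft_apply_apply, e,
        Finset.sum_insert hn]
      have e2 : (fun i => v (Fin.snoc (α := fun _ => ℕ) (fun i => asc n S i + 1) (2*n+2) i)) =
          (Matrix.vecCons (v (2*n+2)) (fun c : Fin n => v (asc n S c + 1))) ∘ (finRotate (n+1)) := by
        rw [Fin.snoc_eq_cons_rotate]
        funext i
        simp only [Function.comp]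
        generalize finRotate (n+1) i = j
        refine Fin.cases ?_ (fun c => ?_) j <;> simp
      rw [e2, AlternatingMap.map_perm, sign_finRotate]
      simp only [id, Nat.add_sub_cancel]
      rw [Units.smul_def, smul_smul, ← neg_smul]
      congr 1
      push_cast
      rw [← pow_add, show n + 1 + ∑ x ∈ S, x + n = 2*n + 1 + ∑ x ∈ S, x by ring,
        pow_add, pow_succ, pow_mul]
      simp

/-- Jacobi–Trudi type determinant attached to `asc`. -/
noncomputable def DD (n : ℕ) (S : Finset ℕ) : SymFn :=
  Matrix.det (Matrix.of fun i j : Fin n => hh ((asc n S i : ℤ) - (j:ℕ)))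

theorem det_expand (n : ℕ) :
    Matrix.det (Matrix.of fun i c : Fin n => hh ((c:ℕ) - (i:ℕ) : ℤ) - hh ((2*n - c : ℕ) - (i:ℕ) : ℤ)) =
    ∑ S ∈ (Finset.Icc 1 n).powerset, (-1:ℤ)^(S.sum id) • DD n S := by
  rw [← Matrix.det_transpose]
  exact alt_expand n (Matrix.detRowAlternating (n := Fin n) (R := SymFn)) (fun c i => hh ((c:ℤ) - (i:ℕ)))

theorem DD_succ (n : ℕ) (S : Finset ℕ) (h : n+1 ∉ S) : DD (n+1) S = DD n S := by
  unfold DD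
  rw [Matrix.det_succ_row_zero, Fin.sum_univ_succ, Finset.sum_eq_zero]
  · simp only [Fin.val_zero, pow_zero, one_mul, asc_neg n S h, Matrix.of_apply, Fin.cons_zero, add_zero]
    have : hh (((0:ℕ):ℤ) - ((0:ℕ):ℤ)) = 1 := by simp [hh]
    rw [this, one_mul]
    congr 1
    ext1 i j
    simp
  · intro j _
    simp only [asc_neg n S h, Matrix.of_apply, Fin.cons_zero]
    have : hh (((0:ℕ):ℤ) - ((j.succ:Fin (n+1)):ℕ)) = 0 := by
      rw [hh, if_pos]; simp; omega
    rw [this]; simp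

theorem DD_homog {K ι : Type*} [Field K] [Algebra ℚ K] (s : Finset ι) (x : ι → K) (n : ℕ) (S : Finset ℕ)
    (hS : S ⊆ Finset.Icc 1 n) :
    phi s (fun i => Polynomial.C (x i) * Polynomial.X) (DD n S) =
      Polynomial.X ^ (2 * S.sum id) * Polynomial.C (phi s x (DD n S)) := by
  have hX : (∏ j : Fin n, (Polynomial.X : Polynomial K) ^ (j:ℕ)) ≠ 0 :=
    Finset.prod_ne_zero_iff.2 fun i _ => pow_ne_zero _ Polynomial.X_ne_zero
  have hcX : ∀ m, hc s (fun i => Polynomial.C (x i) * Polynomial.X) m = Polynomial.X ^ m * Polynomial.C (hc s x m) := by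
    intro m
    have : HS s (fun i => Polynomial.C (x i) * Polynomial.X) =
      PowerSeries.rescale (Polynomial.X) (PowerSeries.map Polynomial.C (HS s x)) := by
      unfold HS
      rw [map_prod, map_prod]
      refine Finset.prod_congr rfl fun i _ => ?_
      ext1 m
      rw [PowerSeries.coeff_mk, PowerSeries.coeff_rescale, PowerSeries.coeff_map, PowerSeries.coeff_mk, mul_pow, mul_comm, map_pow]
    rw [hc, this, PowerSeries.coeff_rescale, PowerSeries.coeff_map, hc]
  apply mul_left_cancel₀ hX
  unfold DD
  rw [AlgHom.map_det, AlgHom.map_det, ← Matrix.det_mul_row, ← mul_assoc]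
  have : (∏ j : Fin n, (Polynomial.X : Polynomial K) ^ (j:ℕ)) * Polynomial.X ^ (2 * S.sum id) =
      ∏ j : Fin n, (Polynomial.X : Polynomial K) ^ (asc n S j) := by
    rw [Finset.prod_pow_eq_pow_sum, Finset.prod_pow_eq_pow_sum, ← pow_add, sum_asc n S hS]
  rw [this, RingHom.map_det, ← Matrix.det_mul_column]
  congr 1
  ext1 i j
  simp only [Matrix.of_apply, AlgHom.mapMatrix_apply, RingHom.mapMatrix_apply, Matrix.map_apply, phi_hh]
  unfold hz
  split_ifs with h
  · simp
  · rw [hcX, ← mul_assoc, ← pow_add]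
    congr 2; omega

end PartThree

section PartFour

theorem sortedParts_coe (l : List ℕ) (h : l.Pairwise (· ≥ ·)) : sortedParts (l : Multiset ℕ) = l := by
  unfold sortedParts
  have h1 : ((l : Multiset ℕ).sort (· ≤ ·)).Perm l.reverse := by
    rw [← Multiset.coe_eq_coe, Multiset.sort_eq]
    exact (Multiset.coe_eq_coe.2 l.reverse_perm).symm
  have h2 : (l : Multiset ℕ).sort (· ≤ ·) = l.reverse :=
    h1.eq_of_pairwise (le := (· ≤ ·)) (fun a b _ _ => le_antisymm) (Multiset.pairwise_sort _ _)
      (by rw [List.pairwise_reverse]; exact h)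
  rw [h2, List.reverse_reverse]

theorem coe_sortedParts (m : Multiset ℕ) : (sortedParts m : Multiset ℕ) = m := by
  unfold sortedParts
  rw [Multiset.coe_reverse, Multiset.sort_eq]

theorem sortedParts_ge (m : Multiset ℕ) : (sortedParts m).Pairwise (· ≥ ·) := by
  unfold sortedParts
  rw [List.pairwise_reverse]
  exact Multiset.pairwise_sort _ _

theorem mem_sortedParts (m : Multiset ℕ) (x : ℕ) : x ∈ sortedParts m ↔ x ∈ m := by
  rw [← Multiset.mem_coe, coe_sortedParts]

theorem sortedParts_gt (S : Finset ℕ) : (sortedParts S.val).Pairwise (· > ·) := by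
  have h1 := sortedParts_ge S.val
  have h2 : (sortedParts S.val).Nodup := by
    rw [← Multiset.coe_nodup, coe_sortedParts]; exact S.nodup
  exact (h1.and h2).imp fun h => lt_of_le_of_ne h.1 (Ne.symm h.2)

theorem sortedParts_max (S : Finset ℕ) (n : ℕ) (hn : n ∈ S) (h : ∀ x ∈ S, x ≤ n) :
    sortedParts S.val = n :: sortedParts (S.erase n).val := by
  have : S.val = ((n :: sortedParts (S.erase n).val : List ℕ) : Multiset ℕ) := by
    rw [← Multiset.cons_coe, coe_sortedParts, Finset.erase_val, Multiset.cons_erase hn]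
  conv_lhs => rw [this]
  apply sortedParts_coe
  rw [List.pairwise_cons]
  refine ⟨fun a ha => ?_, sortedParts_ge _⟩
  rw [mem_sortedParts] at ha
  exact h a (Finset.mem_of_mem_erase ha)

/-- the list underlying gammaFrob -/
def gl (b : List ℕ) : List ℕ :=
  (((List.range b.length).map fun i => b.getD i 0 + i)
    ++ ((List.range (b.getD 0 0 + 1 - b.length)).map fun t =>
        ((List.range b.length).filter fun j => b.length + t ≤ b.getD j 0 + j).length) : List ℕ)

theorem gammaFrob_eq (β : Multiset ℕ) : gammaFrob β = (gl (sortedParts β) : Multiset ℕ) := rfl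

theorem countP_range (p : ℕ → Prop) [DecidablePred p] (n : ℕ) :
    (List.range n).countP (fun i => decide (p i)) = Nat.count p n := by
  induction n with
  | zero => simp
  | succ n ih => rw [List.range_succ, List.countP_append, ih, Nat.count_succ]; simp [List.countP_cons]

theorem count_thresh (p : ℕ → Prop) [DecidablePred p] (n m : ℕ) (hm : m ≤ n)
    (h : ∀ t < n, p t ↔ t < m) : Nat.count p n = m := by
  rw [Nat.count_eq_card_filter_range]
  have : (Finset.range n).filter p = Finset.range m := by
    ext t
    rw [Finset.mem_filter, Finset.mem_range, Finset.mem_range]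
    constructor
    · rintro ⟨a, b⟩; exact (h t a).1 b
    · intro ht; exact ⟨by omega, (h t (by omega)).2 ht⟩
  rw [this, Finset.card_range]

/-- parts of the conjugate of gammaFrob -/
def GG (b : List ℕ) (i : ℕ) : ℕ :=
  if i < b.length then b.getD i 0 + i + 1 else Nat.count (fun t => i < b.getD t 0 + t) b.length

theorem strict_lt (m : ℕ) (b : List ℕ) (h : (m :: b).Pairwise (· > ·)) (t : ℕ) (ht : t < b.length) :
    b.getD t 0 + t < m := by
  induction b generalizing m t with
  | nil => simp at ht
  | cons c b ih =>
    rw [List.pairwise_cons] at h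
    have hc := h.1 c (by simp)
    cases t with
    | zero => simpa using hc
    | succ t =>
      have := ih c h.2 t (by simpa using ht)
      simp only [List.getD_cons_succ]
      omega

theorem strict_anti (b : List ℕ) (h : b.Pairwise (· > ·)) (s t : ℕ) (hst : s ≤ t) (ht : t < b.length) :
    b.getD t 0 + t ≤ b.getD s 0 + s := by
  induction b generalizing s t with
  | nil => simp at ht
  | cons c b ih =>
    cases t with
    | zero => have : s = 0 := by omega
              subst this; rfl
    | succ t =>
      cases s with
      | zero =>
        have := strict_lt c b h t (by simpa using ht)
        simp only [List.getD_cons_succ, List.getD_cons_zero]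
        omega
      | succ s =>
        have := ih (List.pairwise_cons.1 h).2 s t (by omega) (by simpa using ht)
        simp only [List.getD_cons_succ]
        omega

theorem GG_nil (i : ℕ) : GG [] i = 0 := by simp [GG]

theorem GG_cons_zero (m : ℕ) (b : List ℕ) : GG (m :: b) 0 = m + 1 := by simp [GG]

theorem GG_cons_succ (m : ℕ) (b : List ℕ) (h : (m :: b).Pairwise (· > ·)) (hp : ∀ x ∈ b, 0 < x) (i : ℕ) :
    GG (m :: b) (i+1) = if i + 1 < m then GG b i + 1 else 0 := by
  unfold GG
  by_cases hi : i < b.length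
  · have h1 := strict_lt m b h i hi
    have h2 : 0 < b.getD i 0 := by
      rw [List.getD_eq_getElem _ _ hi]; exact hp _ (List.getElem_mem _)
    rw [if_pos (by simpa using hi), if_pos (by omega), if_pos hi]
    simp only [List.getD_cons_succ]; omega
  · rw [if_neg (by simpa using hi), if_neg hi, List.length_cons, Nat.count_succ']
    have e : Nat.count (fun k => i + 1 < (m :: b).getD (k+1) 0 + (k+1)) b.length =
        Nat.count (fun t => i < b.getD t 0 + t) b.length := by
      congr 1
      funext k
      simp only [List.getD_cons_succ]
      apply propext; omega
    rw [e]
    by_cases hm : i + 1 < m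
    · simp [hm]
    · rw [if_neg hm]
      have : Nat.count (fun t => i < b.getD t 0 + t) b.length = 0 := by
        apply count_thresh _ _ _ (by omega)
        intro t ht
        have := strict_lt m b h t ht
        omega
      rw [this]; simpa using hm

theorem GG_zero (b : List ℕ) (h : b.Pairwise (· > ·)) (hp : ∀ x ∈ b, 0 < x) (n : ℕ) (hn : ∀ x ∈ b, x ≤ n) :
    GG b n = 0 := by
  cases b with
  | nil => exact GG_nil n
  | cons m b =>
    have h1 := hp m (by simp)
    have h2 := hn m (by simp)
    cases n with
    | zero => omega
    | succ n => rw [GG_cons_succ m b h (fun x hx => hp x (by simp [hx])), if_neg (by omega)]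

theorem countP_gl (b : List ℕ) (h : b.Pairwise (· > ·)) (hp : ∀ x ∈ b, 0 < x) (i : ℕ) :
    (gl b).countP (fun x => decide (i < x)) = GG b i := by
  have hpos : ∀ t < b.length, b.length ≤ b.getD t 0 + t := by
    intro t ht
    have h1 := strict_anti b h t (b.length - 1) (by omega) (by omega)
    have h2 : 0 < b.getD (b.length-1) 0 := by
      rw [List.getD_eq_getElem _ _ (by omega)]; exact hp _ (List.getElem_mem _)
    omega
  unfold gl GG
  rw [List.countP_append, List.countP_map, List.countP_map]
  simp only [Function.comp_def, ← List.countP_eq_length_filter]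
  simp only [countP_range (fun j => b.length + _ ≤ b.getD j 0 + j)]
  rw [countP_range (fun t => i < b.getD t 0 + t),
    countP_range (fun t => i < Nat.count (fun j => b.length + t ≤ b.getD j 0 + j) b.length)]
  split_ifs with hi
  · rw [count_thresh _ b.length b.length le_rfl (fun t ht => by have := hpos t ht; omega)]
    have h0 := strict_anti b h 0 i (by omega) hi
    have hpi := hpos i hi
    rw [count_thresh _ (b.getD 0 0 + 1 - b.length) (b.getD i 0 + i + 1 - b.length) (by omega)]
    · omega
    · intro t ht
      trans b.length + t ≤ b.getD i 0 + i
      · constructor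
        · intro hc
          by_contra hcon
          have : Nat.count (fun j => b.length + t ≤ b.getD j 0 + j) b.length ≤ i := by
            rw [Nat.count_eq_card_filter_range]
            calc _ ≤ (Finset.range i).card := by
                  apply Finset.card_le_card
                  intro j hj
                  rw [Finset.mem_filter, Finset.mem_range] at hj
                  rw [Finset.mem_range]
                  by_contra hji
                  have := strict_anti b h i j (by omega) hj.1
                  omega
              _ = i := by simp
          omega
        · intro hc
          calc i < i + 1 := by omega
            _ = Nat.count (fun j => b.length + t ≤ b.getD j 0 + j) (i+1) := by
              symm
              apply count_thresh _ _ _ le_rfl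
              intro s hs
              have := strict_anti b h s i (by omega) hi
              omega
            _ ≤ _ := Nat.count_monotone _ (by omega)
      · omega
  · rw [count_thresh _ (b.getD 0 0 + 1 - b.length) 0 (by omega)]
    · rfl
    · intro t ht
      have : Nat.count (fun j => b.length + t ≤ b.getD j 0 + j) b.length ≤ b.length := Nat.count_le _
      omega

theorem sup_gl (m : ℕ) (b : List ℕ) (h : (m :: b).Pairwise (· > ·)) (hp : ∀ x ∈ m :: b, 0 < x) :
    (gl (m :: b) : Multiset ℕ).sup = m := by
  have hm := hp m (by simp)
  apply le_antisymm
  · rw [Multiset.sup_le]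
    intro x hx
    rw [Multiset.mem_coe, gl, List.mem_append, List.mem_map, List.mem_map] at hx
    rcases hx with ⟨t, ht, rfl⟩ | ⟨t, ht, rfl⟩
    · have := strict_anti (m :: b) h 0 t (by omega) (by simpa using ht)
      simpa using this
    · refine (List.length_filter_le _ _).trans ?_
      rw [List.length_range, List.length_cons]
      rcases Nat.eq_zero_or_pos b.length with h0 | h0
      · omega
      · have h1 := strict_lt m b h (b.length - 1) (by omega)
        have h2 : 0 < b.getD (b.length-1) 0 := by
          rw [List.getD_eq_getElem _ _ (by omega)]; exact hp _ (by simp)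
        omega
  · apply Multiset.le_sup
    rw [Multiset.mem_coe, gl, List.mem_append, List.mem_map]
    left
    exact ⟨0, by simp, by simp⟩

theorem schur_conj (m : Multiset ℕ) (N : ℕ) (hN : m.sup = N) : schur (conj m) =
    Matrix.det (Matrix.of fun i j : Fin N =>
      hh ((Multiset.card (m.filter fun x => (i:ℕ) < x) : ℤ) + (j:ℕ) - (i:ℕ))) := by
  subst hN
  have hs : sortedParts (conj m) = (List.range m.sup).map fun i => Multiset.card (m.filter fun x => i < x) := by
    unfold conj
    apply sortedParts_coe
    rw [List.pairwise_map]
    refine List.pairwise_lt_range.imp ?_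
    intro a b hab
    apply Multiset.card_le_card
    apply Multiset.monotone_filter_right
    intro x hx
    omega
  have hcard : Multiset.card (conj m) = m.sup := by
    unfold conj; simp
  unfold schur
  rw [hs]
  rw [← Matrix.det_submatrix_equiv_self (finCongr hcard)]
  congr 1
  ext1 i j
  have hi : (i:ℕ) < m.sup := hcard ▸ i.2
  simp [hi]

theorem asc_rev (n : ℕ) (S : Finset ℕ) (hS : S ⊆ Finset.Icc 1 n) (i : Fin n) :
    asc n S i.rev = GG (sortedParts S.val) i + (n - 1 - i) := by
  induction n generalizing S with
  | zero => exact i.elim0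
  | succ n ih =>
    have hp : ∀ x ∈ sortedParts S.val, 0 < x := by
      intro x hx
      rw [mem_sortedParts] at hx
      have := Finset.mem_Icc.1 (hS hx); omega
    have hS' : S.erase (n+1) ⊆ Finset.Icc 1 n := by
      intro x hx
      rw [Finset.mem_erase] at hx
      have := Finset.mem_Icc.1 (hS hx.2)
      rw [Finset.mem_Icc]; omega
    by_cases h : n+1 ∈ S
    · have e : asc n S = asc n (S.erase (n+1)) :=
        asc_congr _ _ _ fun m hm => by simp; intro _; omega
      have hgt := sortedParts_gt S
      have hmax := sortedParts_max S (n+1) h (fun x hx => (Finset.mem_Icc.1 (hS hx)).2)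
      rw [hmax] at hgt hp ⊢
      rw [asc_pos n S h]
      refine Fin.cases ?_ (fun i => ?_) i
      · rw [Fin.rev_zero, Fin.snoc_last, Fin.val_zero, GG_cons_zero]; omega
      · rw [Fin.rev_succ, Fin.snoc_castSucc, e, ih _ hS', Fin.val_succ,
          GG_cons_succ _ _ hgt (fun x hx => hp x (List.mem_cons_of_mem _ hx)), if_pos (by omega)]
        have := i.2
        omega
    · rw [Finset.erase_eq_of_notMem h] at hS'
      rw [asc_neg n S h]
      refine Fin.lastCases ?_ (fun i => ?_) i
      · rw [Fin.rev_last, Fin.cons_zero, Fin.val_last, GG_zero _ (sortedParts_gt S) hp]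
        · simp
        · intro x hx
          rw [mem_sortedParts] at hx
          exact (Finset.mem_Icc.1 (hS' hx)).2
      · rw [Fin.rev_castSucc, Fin.cons_succ, ih S hS', Fin.val_castSucc]
        have := i.2
        omega

theorem schur_eq_DD (n : ℕ) (S : Finset ℕ) (hS : S ⊆ Finset.Icc 1 n) :
    schur (conj (gammaFrob S.val)) = DD n S := by
  induction n with
  | zero =>
    simp at hS
    subst hS
    have e : sortedParts (∅ : Finset ℕ).val = [] := sortedParts_coe [] (by simp)
    rw [schur_conj _ 0 (by rw [gammaFrob_eq, e]; simp [gl])]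
    simp [DD]
  | succ n ih =>
    by_cases h : n+1 ∈ S
    · have hp : ∀ x ∈ sortedParts S.val, 0 < x := by
        intro x hx
        rw [mem_sortedParts] at hx
        have := Finset.mem_Icc.1 (hS hx); omega
      have hgt := sortedParts_gt S
      have hsup : (gammaFrob S.val).sup = n+1 := by
        have hmax := sortedParts_max S (n+1) h (fun x hx => (Finset.mem_Icc.1 (hS hx)).2)
        rw [gammaFrob_eq]
        rw [hmax] at hgt hp ⊢
        exact sup_gl _ _ hgt hp
      rw [schur_conj _ _ hsup, DD, ← Matrix.det_submatrix_equiv_self Fin.revPerm (Matrix.of fun i j : Fin (n+1) => hh ((asc (n+1) S i : ℤ) - (j:ℕ)))]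
      congr 1
      ext1 i j
      rw [Matrix.submatrix_apply, Matrix.of_apply, Matrix.of_apply, Fin.revPerm_apply, Fin.revPerm_apply,
        asc_rev _ _ hS]
      congr 1
      rw [gammaFrob_eq, ← Multiset.countP_eq_card_filter, Multiset.coe_countP, countP_gl _ hgt hp, Fin.val_rev]
      have := i.2
      have := j.2
      omega
    · rw [DD_succ n S h]
      apply ih
      intro x hx
      have := Finset.mem_Icc.1 (hS hx)
      rw [Finset.mem_Icc]
      have : x ≠ n+1 := fun e => h (e ▸ hx)
      omega

end PartFour

section PartFive

theorem map_hz {R R' ι : Type*} [CommRing R] [CommRing R'] (f : R →+* R') (s : Finset ι) (y : ι → R) (m : ℤ) :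
    f (hz s y m) = hz s (fun i => f (y i)) m := by
  have : ∀ m, f (hc s y m) = hc s (fun i => f (y i)) m := by
    intro m
    unfold hc
    rw [← PowerSeries.coeff_map]
    congr 1
    unfold HS
    rw [map_prod]
    refine Finset.prod_congr rfl fun i _ => ?_
    ext1 m
    rw [PowerSeries.coeff_map, PowerSeries.coeff_mk, PowerSeries.coeff_mk, map_pow]
  unfold hz
  split_ifs
  · simp
  · exact this _

theorem det_hz_dom {R : Type*} [CommRing R] [IsDomain R] {n : ℕ} (y : Fin n → R) (hy : Function.Injective y) :
    (Matrix.of fun i c : Fin n => hz Finset.univ y ((c:ℕ) - (i:ℕ) : ℤ) - hz Finset.univ y ((2*n - c : ℕ) - (i:ℕ) : ℤ)).det =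
    (∏ i, (1 - y i * y i)) * ∏ i, ∏ j ∈ Finset.Ioi i, (1 - y i * y j) := by
  apply mul_left_cancel₀ (Matrix.det_vandermonde_ne_zero_iff.2 hy)
  rw [vand_mul_det, det_typeC]

theorem det_hz {R : Type*} [CommRing R] {n : ℕ} (y : Fin n → R) :
    (Matrix.of fun i c : Fin n => hz Finset.univ y ((c:ℕ) - (i:ℕ) : ℤ) - hz Finset.univ y ((2*n - c : ℕ) - (i:ℕ) : ℤ)).det =
    (∏ i, (1 - y i * y i)) * ∏ i, ∏ j ∈ Finset.Ioi i, (1 - y i * y j) := by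
  have h := det_hz_dom (fun i : Fin n => (MvPolynomial.X i : MvPolynomial (Fin n) ℤ)) (MvPolynomial.X_injective)
  have h2 := congrArg (MvPolynomial.eval₂Hom (Int.castRingHom R) y) h
  rw [RingHom.map_det] at h2
  simp only [map_mul, map_prod, map_sub, map_one, MvPolynomial.coe_eval₂Hom, MvPolynomial.eval₂_X] at h2
  rw [← h2]
  congr 1
  ext1 i j
  rw [RingHom.mapMatrix_apply, Matrix.map_apply, Matrix.of_apply, Matrix.of_apply, map_sub, map_hz, map_hz]
  simp only [MvPolynomial.coe_eval₂Hom, MvPolynomial.eval₂_X]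

/-- pairs `i ≤ j` -/
def prs (n : ℕ) : Finset (Fin n × Fin n) := Finset.univ.filter fun p => p.1 ≤ p.2

theorem prod_prs {R : Type*} [CommRing R] {n : ℕ} (F : Fin n × Fin n → R) :
    ∏ p ∈ prs n, F p = (∏ i, F (i,i)) * ∏ i, ∏ j ∈ Finset.Ioi i, F (i,j) := by
  unfold prs
  rw [Finset.prod_filter, Fintype.prod_prod_type, ← Finset.prod_mul_distrib]
  refine Finset.prod_congr rfl fun i _ => ?_
  rw [← Finset.prod_filter, ← Finset.prod_insert (f := fun j => F (i,j)) (s := Finset.Ioi i) (a := i) (by simp)]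
  refine Finset.prod_congr ?_ fun _ _ => rfl
  ext j
  simp [le_iff_eq_or_lt, eq_comm]

theorem sum_prs {K : Type*} [Field K] [Algebra ℚ K] {n : ℕ} (x : Fin n → K) (k : ℕ) :
    (2:ℚ) • ∑ p ∈ prs n, (x p.1 * x p.2) ^ (k+1) =
      (∑ j, x j ^ (k+1))^2 + ∑ j, x j ^ (2*(k+1)) := by
  unfold prs
  rw [Finset.sum_filter, Fintype.sum_prod_type, sq, Finset.sum_mul_sum, two_smul]
  conv_lhs => 
    arg 2
    rw [Finset.sum_comm]
  rw [← Finset.sum_add_distrib, ← Finset.sum_add_distrib]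
  refine Finset.sum_congr rfl fun i _ => ?_
  rw [← Finset.sum_add_distrib]
  have : x i ^ (2*(k+1)) = ∑ j, if i = j then x i ^ (k+1) * x j ^ (k+1) else 0 := by
    rw [Finset.sum_ite_eq]; simp; ring
  rw [this, ← Finset.sum_add_distrib]
  refine Finset.sum_congr rfl fun j _ => ?_
  rcases lt_trichotomy i j with h | h | h
  · simp [h.le, h.ne, not_le.2 h, mul_pow]
  · subst h; simp [mul_pow]
  · simp [h.le, h.ne', not_le.2 h, mul_pow, mul_comm]

theorem main_spec {K : Type*} [Field K] [Algebra ℚ K] (n : ℕ) (x : Fin n → K) (k : ℕ) :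
    phi Finset.univ x (pleth (ee k) (hh 2)) =
      ∑ S ∈ (Finset.Icc 1 n).powerset.filter (fun S => S.sum id = k),
        phi Finset.univ x (DD n S) := by
  rw [phi_pleth Finset.univ x (prs n) (fun p => x p.1 * x p.2) (sum_prs x)]
  set y : Fin n → Polynomial K := fun i => Polynomial.C (x i) * Polynomial.X with hy
  have h1 := congrArg (phi Finset.univ y) (det_expand n)
  rw [AlgHom.map_det] at h1
  have h2 : (phi Finset.univ y).mapMatrix (Matrix.of fun i c : Fin n => hh ((c:ℕ) - (i:ℕ) : ℤ) - hh ((2*n - c : ℕ) - (i:ℕ) : ℤ)) =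
      (Matrix.of fun i c : Fin n => hz Finset.univ y ((c:ℕ) - (i:ℕ) : ℤ) - hz Finset.univ y ((2*n - c : ℕ) - (i:ℕ) : ℤ)) := by
    ext1 i j
    rw [AlgHom.mapMatrix_apply, Matrix.map_apply, Matrix.of_apply, Matrix.of_apply, map_sub, phi_hh, phi_hh]
  rw [h2, det_hz, map_sum] at h1
  have h3 : (∏ i, (1 - y i * y i)) * ∏ i, ∏ j ∈ Finset.Ioi i, (1 - y i * y j) =
      Polynomial.expand K 2 (EP (prs n) (fun p => x p.1 * x p.2)) := by
    rw [← prod_prs (fun p => 1 - y p.1 * y p.2), EP, map_prod]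
    refine Finset.prod_congr rfl fun p _ => ?_
    simp only [hy, map_sub, map_one, map_mul, Polynomial.expand_C, Polynomial.expand_X]
    ring
  rw [h3] at h1
  have h4 := congrArg (fun q => Polynomial.coeff q (k*2)) h1
  simp only [Polynomial.coeff_expand_mul (show 0 < 2 by norm_num), Polynomial.finsetSum_coeff] at h4
  rw [h4, Finset.mul_sum, Finset.sum_filter]
  refine Finset.sum_congr rfl fun S hS => ?_
  rw [Finset.mem_powerset] at hS
  rw [map_zsmul, hy, DD_homog _ _ _ _ hS, Polynomial.coeff_smul, mul_comm (Polynomial.X ^ _), Polynomial.coeff_C_mul_X_pow]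
  by_cases hk : S.sum id = k
  · rw [if_pos hk, if_pos (by omega), hk, zsmul_eq_mul, ← mul_assoc]
    push_cast
    rw [← mul_pow]; simp
  · rw [if_neg hk, if_neg (by omega)]; simp

theorem exists_spec (f : ℕ → ℂ) (N : ℕ) : ∃ n, N ≤ n ∧ ∃ x : Fin n → ℂ, ∀ m < N, hc Finset.univ x (m+1) = f m := by
  classical
  set F : PowerSeries ℂ := PowerSeries.mk (fun m => if m = 0 then 1 else f (m-1)) with hF
  have hF0 : PowerSeries.constantCoeff F = 1 := by
    rw [← PowerSeries.coeff_zero_eq_constantCoeff_apply, hF, PowerSeries.coeff_mk]; simp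
  set Q : Polynomial ℂ := PowerSeries.trunc (N+1) F⁻¹ with hQ
  have hQ0 : Q.coeff 0 = 1 := by
    rw [hQ, PowerSeries.coeff_trunc, if_pos (by omega), PowerSeries.coeff_zero_eq_constantCoeff_apply,
      PowerSeries.constantCoeff_inv, hF0, inv_one]
  have hsplit := (IsAlgClosed.splits Q).eq_prod_roots
  set W : Multiset ℂ := Q.roots.map (fun r => r⁻¹) + Multiset.replicate N 0 with hW
  have hWprod : (W.map (fun a => 1 - Polynomial.C a * Polynomial.X)).prod = Q := by
    have hne : Q ≠ 0 := by intro h; rw [h] at hQ0; simp at hQ0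
    have hr0 : ∀ r ∈ Q.roots, r ≠ 0 := by
      rintro r hr rfl
      rw [Polynomial.mem_roots hne, Polynomial.IsRoot, ← Polynomial.coeff_zero_eq_eval_zero, hQ0] at hr
      exact one_ne_zero hr
    have e1 : (Q.roots.map (fun r => Polynomial.X - Polynomial.C r)) =
        Q.roots.map (fun r => Polynomial.C (-r) * (1 - Polynomial.C r⁻¹ * Polynomial.X)) := by
      refine Multiset.map_congr rfl fun r hr => ?_
      have : Polynomial.C r * Polynomial.C r⁻¹ = (1 : Polynomial ℂ) := by
        rw [← Polynomial.C_mul, mul_inv_cancel₀ (hr0 r hr), Polynomial.C_1]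
      rw [Polynomial.C_neg]
      linear_combination (-Polynomial.X) * this
    rw [e1, Multiset.prod_map_mul, ← mul_assoc] at hsplit
    set P := (Q.roots.map (fun r => 1 - Polynomial.C r⁻¹ * Polynomial.X)).prod with hP
    have hP0 : P.eval 0 = 1 := by
      rw [hP, Polynomial.eval_multiset_prod, Multiset.map_map]
      apply Multiset.prod_eq_one
      intro a ha
      rw [Multiset.mem_map] at ha
      obtain ⟨r, _, rfl⟩ := ha
      simp
    have e2 : (Q.roots.map (fun r => Polynomial.C (-r))).prod = Polynomial.C (Q.roots.map (fun r => -r)).prod := by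
      rw [map_multiset_prod, Multiset.map_map]; rfl
    rw [e2, ← Polynomial.C_mul] at hsplit
    have e3 := congrArg (Polynomial.eval 0) hsplit
    rw [← Polynomial.coeff_zero_eq_eval_zero, hQ0, Polynomial.eval_mul, hP0, Polynomial.eval_C, mul_one] at e3
    rw [← e3, Polynomial.C_1, one_mul] at hsplit
    rw [hW, Multiset.map_add, Multiset.prod_add, Multiset.map_map, Multiset.map_replicate]
    simp only [Polynomial.C_0, zero_mul, sub_zero, Multiset.prod_replicate, one_pow, mul_one]
    exact hsplit.symm
  refine ⟨W.toList.length, ?_, fun i => W.toList.get i, ?_⟩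
  · rw [Multiset.length_toList, hW]; simp
  · have hEP : EP Finset.univ (fun i => W.toList.get i) = Q := by
      rw [← hWprod]
      conv_rhs => rw [← Multiset.coe_toList W]
      rw [Multiset.map_coe, Multiset.prod_coe, EP, ← List.prod_ofFn]
      congr 1
      rw [← List.ofFn_get (W.toList), List.map_ofFn]
      simp
    have h1 := HS_mul_EP Finset.univ (fun i => W.toList.get i)
    rw [hEP] at h1
    have h2 : F * F⁻¹ = 1 := PowerSeries.mul_inv_cancel _ (by rw [hF0]; exact one_ne_zero)
    have h3 : (PowerSeries.X : PowerSeries ℂ)^(N+1) ∣ F⁻¹ - (Q : PowerSeries ℂ) := by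
      rw [PowerSeries.X_pow_dvd_iff]
      intro m hm
      rw [map_sub, Polynomial.coeff_coe, hQ, PowerSeries.coeff_trunc, if_pos hm, sub_self]
    obtain ⟨G, hG⟩ := h3
    intro m hm
    have h4 : HS Finset.univ (fun i => W.toList.get i) - F =
       PowerSeries.X^(N+1) * (G * HS Finset.univ (fun i => W.toList.get i) * F) := by
      linear_combination (- HS Finset.univ (fun i => W.toList.get i)) * h2 + F * h1 +
        (HS Finset.univ (fun i => W.toList.get i) * F) * hG
    have h5 := (PowerSeries.X_pow_dvd_iff.1 (Dvd.intro _ h4.symm)) (m+1) (by omega)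
    rw [map_sub, sub_eq_zero] at h5
    rw [hc, h5, hF, PowerSeries.coeff_mk]
    simp

theorem sum_parts {A : Type*} [AddCommMonoid A] (k n : ℕ) (hk : k ≤ n) (F : Multiset ℕ → A) :
    ∑ S ∈ (Finset.Icc 1 n).powerset.filter (fun S => S.sum id = k), F S.val =
      ∑ β : {β : Nat.Partition k // β.parts.Nodup}, F β.1.parts := by
  symm
  refine Finset.sum_bij (fun β _ => ⟨β.1.parts, β.2⟩) ?_ ?_ ?_ ?_
  · intro β _
    rw [Finset.mem_filter, Finset.mem_powerset]
    refine ⟨fun a ha => ?_, ?_⟩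
    · have ha : a ∈ β.1.parts := ha
      rw [Finset.mem_Icc]
      have h1 := β.1.parts_pos ha
      have h2 := Multiset.le_sum_of_mem ha
      rw [β.1.parts_sum] at h2
      omega
    · change (β.1.parts.map id).sum = k
      rw [Multiset.map_id, β.1.parts_sum]
  · intro a _ b _ h
    apply Subtype.ext
    apply Nat.Partition.ext
    exact congrArg Finset.val h
  · intro S hS
    rw [Finset.mem_filter, Finset.mem_powerset] at hS
    refine ⟨⟨⟨S.val, ?_, ?_⟩, S.nodup⟩, Finset.mem_univ _, rfl⟩
    · intro i hi
      have := Finset.mem_Icc.1 (hS.1 hi); omega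
    · have := hS.2
      change (S.val.map id).sum = k at this
      rwa [Multiset.map_id] at this
  · intro β _; rfl

end PartFive

/-- `e_k ∘ h₂ = ∑_{β ⊢ k strict} s_{Γ(β)'}` where
`Γ(β) = (β₁-1, β₂-1, … | β₁, β₂, …)` in Frobenius notation. -/
theorem ek_pleth_h2 (k : ℕ) :
    pleth (ee k) (hh 2) =
      ∑ β : {β : Nat.Partition k // β.parts.Nodup}, schur (conj (gammaFrob β.1.parts)) := by
  classical
  rw [← sub_eq_zero]
  set P := pleth (ee k) (hh 2) -
    ∑ β : {β : Nat.Partition k // β.parts.Nodup}, schur (conj (gammaFrob β.1.parts)) with hP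
  apply MvPolynomial.funext
  intro f
  obtain ⟨n, hn, x, hx⟩ := exists_spec (fun m => (f m : ℂ)) (k + P.vars.sup id + 1)
  have h0 : phi Finset.univ x P = 0 := by
    rw [hP, map_sub, main_spec, ← sum_parts k n (by omega) (fun m => schur (conj (gammaFrob m))), map_sum, sub_eq_zero]
    refine Finset.sum_congr rfl fun S hS => ?_
    rw [Finset.mem_filter, Finset.mem_powerset] at hS
    rw [schur_eq_DD n S hS.1]
  have h1 : phi Finset.univ x P = aeval (fun m => (f m : ℂ)) P := by
    unfold phi
    refine MvPolynomial.eval₂Hom_congr' rfl (fun i hi _ => ?_) rfl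
    apply hx
    have : i ≤ P.vars.sup id := Finset.le_sup (f := id) hi
    omega
  have h2 : aeval (fun m => (f m : ℂ)) P = ((MvPolynomial.eval f P : ℚ) : ℂ) := by
    have := MvPolynomial.aeval_algebraMap_apply (A := ℚ) ℂ f P
    rw [MvPolynomial.aeval_eq_eval] at this
    exact this
  rw [h1, h2] at h0
  rw [map_zero]
  exact_mod_cast h0
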